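/- arXiv:2509.22109 — 2 statements merged into one kernel-verified Lean document; each statement's English description precedes it below -/
import Mathlib

section
/- Let c ∈ 𝕋 with c ≠ 0 and let μ be a g-measure for g^c. Then for every n ∈ ℕ, every word w ∈ {0,1}^n and every word v ∈ {0,1}^m (m ≥ 0, with ⟨v⟩ = 𝕋 when v is the empty word), one has log μ(⟨v⟩) + inf_{x∈⟨wv⟩} ψ^c_n(x) ≤ log μ(⟨wv⟩) ≤ log μ(⟨v⟩) + sup_{x∈⟨wv⟩} ψ^c_n(x), as inequalities in ℝ ∪ {−∞}; in particular, for v the empty word, inf_{x∈⟨w⟩} ψ^c_n(x) ≤ log μ(⟨w⟩) ≤ sup_{x∈⟨w⟩} ψ^c_n(x). -/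
open MeasureTheory Filter Topology Set
open scoped ENNReal

noncomputable section

namespace GTM

abbrev Torus := AddCircle (1 : ℝ)

instance : Fact ((0:ℝ) < 1) := ⟨one_pos⟩

/-- The doubling map on the torus. -/
def dbl (x : Torus) : Torus := x + x

/-- The function `x ↦ |cos (π x)|` lifted to the torus. -/
def absCos : Torus → ℝ :=
  Function.Periodic.lift (f := fun x : ℝ => |Real.cos (Real.pi * x)|)
    (by
      intro x
      simp [mul_add, mul_one, Real.cos_add_pi, abs_neg])

/-- The potential `ψ^c(x) = 2 log |cos (π (x - c))|`, with value `⊥ = -∞` at the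
singularity `c + 1/2`. -/
def psi (c : Torus) (x : Torus) : EReal :=
  if absCos (x - c) = 0 then ⊥ else ((2 * Real.log (absCos (x - c)) : ℝ) : EReal)

/-- The Birkhoff sums `ψ^c_n` of the potential `ψ^c` under the doubling map. -/
def psiSum (c : Torus) (n : ℕ) (x : Torus) : EReal :=
  ∑ k ∈ Finset.range n, psi c (dbl^[k] x)

/-- The left endpoint of the dyadic cylinder interval of a binary word. -/
def wordVal (n : ℕ) (ω : Fin n → Bool) : ℝ :=
  ∑ i : Fin n, (if ω i then (1 : ℝ) else 0) / 2 ^ ((i : ℕ) + 1)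

/-- The closed dyadic interval `⟨ω⟩ ⊆ 𝕋` associated to a binary word `ω`. -/
def cyl (n : ℕ) (ω : Fin n → Bool) : Set Torus :=
  (fun x : ℝ => (x : Torus)) '' Set.Icc (wordVal n ω) (wordVal n ω + 1 / 2 ^ n)

/-- The exponential function on extended reals, `exp ⊥ = 0`, `exp ⊤ = ∞`. -/
def eexp (x : EReal) : ℝ≥0∞ :=
  if x = ⊥ then 0 else if x = ⊤ then ⊤ else ENNReal.ofReal (Real.exp x.toReal)

/-- The logarithm on `ℝ≥0∞`, `log 0 = ⊥`, `log ∞ = ⊤`. -/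
def elog (x : ℝ≥0∞) : EReal :=
  if x = 0 then ⊥ else if x = ⊤ then ⊤ else ((Real.log x.toReal : ℝ) : EReal)

/-- The partition function `Σ_{ω ∈ {0,1}ⁿ} exp (t · sup_{x ∈ ⟨ω⟩} ψ^c_n(x))`. -/
def presZ (c : Torus) (t : ℝ) (n : ℕ) : ℝ≥0∞ :=
  ∑ ω : Fin n → Bool, eexp ((t : EReal) * ⨆ x ∈ cyl n ω, psiSum c n x)

/-- The upper topological pressure `P̄_top(t ψ^c)`. -/
def presUpper (c : Torus) (t : ℝ) : EReal :=
  atTop.limsup fun n : ℕ => (((n : ℝ)⁻¹ : ℝ) : EReal) * elog (presZ c t n)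

/-- The lower topological pressure `P̲_top(t ψ^c)`. -/
def presLower (c : Torus) (t : ℝ) : EReal :=
  atTop.liminf fun n : ℕ => (((n : ℝ)⁻¹ : ℝ) : EReal) * elog (presZ c t n)

/-- The `g`-function `g^c(x) = cos² (π (x - c))`. -/
def gfun (c : Torus) (x : Torus) : ℝ := (absCos (x - c)) ^ 2

/-- The halving map `x ↦ x/2` on the torus, computed on the representative in `[0,1)`. -/
def half (x : Torus) : Torus := (((AddCircle.equivIco 1 0 x : ℝ) / 2 : ℝ) : Torus)

/-- `μ` is a `g`-measure for `g^c`: it is a Borel probability measure invariant under the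
dual transfer operator of `g^c`. -/
def IsGMeasure (c : Torus) (μ : Measure Torus) : Prop :=
  IsProbabilityMeasure μ ∧
    ∀ f : C(Torus, ℝ),
      ∫ x, f x ∂μ =
        ∫ x,
          (gfun c (half x) * f (half x) +
            gfun c (half x + (((1 : ℝ) / 2 : ℝ) : Torus)) *
              f (half x + (((1 : ℝ) / 2 : ℝ) : Torus))) ∂μ

/-! ### The logarithmic and exponential conventions -/

theorem elog_eq_log (x : ℝ≥0∞) : elog x = ENNReal.log x := rfl

theorem absCos_coe (x : ℝ) : absCos (x : Torus) = |Real.cos (Real.pi * x)| := rfl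

theorem absCos_nonneg (x : Torus) : 0 ≤ absCos x := by
  induction x using QuotientAddGroup.induction_on with
  | H t => exact abs_nonneg _

theorem absCos_le_one (x : Torus) : absCos x ≤ 1 := by
  induction x using QuotientAddGroup.induction_on with
  | H t => exact Real.abs_cos_le_one _

theorem continuous_absCos : Continuous absCos := by
  have h : Continuous fun x : ℝ => |Real.cos (Real.pi * x)| := by fun_prop
  exact h.quotient_lift _

theorem continuous_gfun (c : Torus) : Continuous (gfun c) :=
  (continuous_absCos.comp (continuous_id.sub continuous_const)).pow 2

theorem gfun_nonneg (c x : Torus) : 0 ≤ gfun c x := sq_nonneg _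

theorem exp_psi (c x : Torus) : EReal.exp (psi c x) = ENNReal.ofReal (gfun c x) := by
  unfold psi gfun
  split_ifs with h
  · simp [h]
  · have hpos : 0 < absCos (x - c) := lt_of_le_of_ne (absCos_nonneg _) (Ne.symm h)
    rw [EReal.exp_coe, two_mul, Real.exp_add, Real.exp_log hpos, sq]

theorem measurable_exp_psi (c : Torus) : Measurable fun x => EReal.exp (psi c x) := by
  simp_rw [exp_psi]
  exact (continuous_gfun c).measurable.ennreal_ofReal

theorem exp_psiSum_succ (c : Torus) (n : ℕ) (x : Torus) :
    EReal.exp (psiSum c (n + 1) x) =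
      EReal.exp (psiSum c n (dbl x)) * EReal.exp (psi c x) := by
  rw [← EReal.exp_add, psiSum, Finset.sum_range_succ']
  rfl

/-- Away from the origin the centre `c` makes `g^c` strictly contracting at the fixed point. -/
theorem gfun_zero_lt_one {c : Torus} (hc : c ≠ 0) : gfun c 0 < 1 := by
  have h1 : absCos (0 - c) ≠ 1 := by
    induction c using QuotientAddGroup.induction_on with
    | H t =>
      intro h
      have h' : |Real.cos (Real.pi * -t)| = 1 := by
        rw [← absCos_coe]
        simpa using h
      have hs : Real.sin (Real.pi * -t) = 0 := by
        have := Real.sin_sq_add_cos_sq (Real.pi * -t)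
        rw [← sq_abs (Real.cos _), h'] at this
        nlinarith
      obtain ⟨k, hk⟩ := Real.sin_eq_zero_iff.1 hs
      apply hc
      have : t = ((-k : ℤ) : ℝ) := by
        have hpi := Real.pi_ne_zero
        push_cast
        have : Real.pi * (t + k) = 0 := by linarith
        have := (mul_eq_zero.1 this).resolve_left hpi
        linarith
      exact (AddCircle.coe_eq_zero_iff (1 : ℝ)).2 ⟨-k, by simp [this]⟩
  have h2 : absCos (0 - c) < 1 := lt_of_le_of_ne (absCos_le_one _) h1
  have h0 := absCos_nonneg (0 - c)
  unfold gfun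
  nlinarith

/-! ### Inverse branches of the doubling map -/

/-- The representative in `[0,1)` of a point of the torus. -/
def rep (x : Torus) : ℝ := AddCircle.equivIco 1 0 x

theorem rep_nonneg (x : Torus) : 0 ≤ rep x := (AddCircle.equivIco 1 0 x).2.1

theorem rep_lt_one (x : Torus) : rep x < 1 :=
  lt_of_lt_of_eq (AddCircle.equivIco (1 : ℝ) 0 x).2.2 (zero_add 1)

theorem coe_rep (x : Torus) : (rep x : Torus) = x := AddCircle.coe_equivIco

theorem rep_coe {t : ℝ} (h0 : 0 ≤ t) (h1 : t < 1) : rep (t : Torus) = t :=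
  AddCircle.equivIco_coe_of_mem (p := (1 : ℝ)) (a := 0) ⟨h0, by simpa using h1⟩

theorem measurable_rep : Measurable rep :=
  measurable_subtype_coe.comp (AddCircle.measurableEquivIco (1 : ℝ) 0).measurable

theorem measurable_coe_torus : Measurable ((↑) : ℝ → Torus) :=
  (AddCircle.continuous_mk' (1 : ℝ)).measurable

/-- The numerical value of a binary digit. -/
def digit (a : Bool) : ℝ := if a then 1 else 0

theorem digit_nonneg (a : Bool) : 0 ≤ digit a := by cases a <;> simp [digit]

theorem digit_le_one (a : Bool) : digit a ≤ 1 := by cases a <;> simp [digit]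

/-- The inverse branch of the doubling map with values in `[a/2, (a+1)/2)`. -/
def preim (a : Bool) (x : Torus) : Torus := (((digit a + rep x) / 2 : ℝ) : Torus)

theorem measurable_preim (a : Bool) : Measurable (preim a) :=
  measurable_coe_torus.comp ((measurable_rep.const_add _).div_const _)

theorem half_eq_preim (x : Torus) : half x = preim false x := by
  simp [half, preim, digit, rep]

theorem half_add_eq_preim (x : Torus) :
    half x + (((1 : ℝ) / 2 : ℝ) : Torus) = preim true x := by
  rw [half, preim, ← AddCircle.coe_add]
  congr 1
  simp only [digit, rep, if_true]
  ring

theorem rep_preim (a : Bool) (x : Torus) : rep (preim a x) = (digit a + rep x) / 2 :=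
  rep_coe (by linarith [digit_nonneg a, rep_nonneg x])
    (by linarith [digit_le_one a, rep_lt_one x])

theorem dbl_coe (t : ℝ) : dbl (t : Torus) = ((2 * t : ℝ) : Torus) := by
  rw [dbl, ← AddCircle.coe_add, two_mul]

theorem dbl_iterate_coe (n : ℕ) (t : ℝ) : dbl^[n] (t : Torus) = ((2 ^ n * t : ℝ) : Torus) := by
  induction n generalizing t with
  | zero => simp
  | succ n ih => rw [Function.iterate_succ_apply, dbl_coe, ih, pow_succ, mul_assoc]

theorem coe_intCast_torus (k : ℤ) : (((k : ℤ) : ℝ) : Torus) = 0 :=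
  (AddCircle.coe_eq_zero_iff (1 : ℝ)).2 ⟨k, by simp⟩

theorem dbl_preim (a : Bool) (x : Torus) : dbl (preim a x) = x := by
  have hd : ((digit a : ℝ) : Torus) = 0 := by
    cases a <;> simp [digit]
  rw [preim, dbl_coe, mul_div_cancel₀ _ two_ne_zero, AddCircle.coe_add, hd, coe_rep, zero_add]

theorem preim_injective (a : Bool) : Function.Injective (preim a) :=
  Function.LeftInverse.injective (dbl_preim a)

theorem preim_ne_preim {a b : Bool} (h : a ≠ b) (x y : Torus) : preim a x ≠ preim b y := by
  intro hxy
  have hx : x = y := by rw [← dbl_preim a x, hxy, dbl_preim]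
  have hr := congrArg rep hxy
  rw [rep_preim, rep_preim, hx] at hr
  have hd : digit a = digit b := by linarith
  cases a <;> cases b <;> simp_all [digit]

/-- The inverse branch of the `n`-th iterate of the doubling map given by the word `w`. -/
def branch (n : ℕ) (w : Fin n → Bool) (x : Torus) : Torus :=
  ((wordVal n w + rep x / 2 ^ n : ℝ) : Torus)

theorem wordVal_nonneg (n : ℕ) (w : Fin n → Bool) : 0 ≤ wordVal n w :=
  Finset.sum_nonneg fun i _ => div_nonneg (digit_nonneg (w i)) (by positivity)

theorem wordVal_succ (n : ℕ) (w : Fin (n + 1) → Bool) :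
    wordVal (n + 1) w = (digit (w 0) + wordVal n (Fin.tail w)) / 2 := by
  rw [wordVal, Fin.sum_univ_succ, wordVal, add_div, Finset.sum_div]
  congr 1
  · simp [digit]
  · refine Finset.sum_congr rfl fun i _ => ?_
    rw [div_div, Fin.val_succ, pow_succ _ ((i : ℕ) + 1)]
    rfl

theorem wordVal_append (n m : ℕ) (w : Fin n → Bool) (v : Fin m → Bool) :
    wordVal (n + m) (Fin.append w v) = wordVal n w + wordVal m v / 2 ^ n := by
  rw [wordVal, Fin.sum_univ_add, wordVal, wordVal, Finset.sum_div]
  congr 1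
  · simp
  · refine Finset.sum_congr rfl fun i _ => ?_
    rw [Fin.append_right, Fin.val_natAdd, div_div, ← pow_add]
    congr 2
    omega

theorem wordVal_add_le_one (n : ℕ) (w : Fin n → Bool) : wordVal n w + 1 / 2 ^ n ≤ 1 := by
  induction n with
  | zero => simp [wordVal]
  | succ n ih =>
    have h := ih (Fin.tail w)
    have hd := digit_le_one (w 0)
    have hp : (1 : ℝ) / 2 ^ (n + 1) = 1 / 2 ^ n / 2 := by rw [pow_succ, div_div]
    rw [wordVal_succ, hp]
    linarith

theorem exists_int_two_pow_mul_wordVal (n : ℕ) (w : Fin n → Bool) :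
    ∃ k : ℤ, 2 ^ n * wordVal n w = k := by
  induction n with
  | zero => exact ⟨0, by simp [wordVal]⟩
  | succ n ih =>
    obtain ⟨k, hk⟩ := ih (Fin.tail w)
    refine ⟨2 ^ n * (if w 0 then 1 else 0) + k, ?_⟩
    rw [wordVal_succ, digit]
    push_cast
    rw [← hk]
    ring

theorem branch_arg_lt (n : ℕ) (w : Fin n → Bool) (x : Torus) :
    wordVal n w + rep x / 2 ^ n < wordVal n w + 1 / 2 ^ n := by
  have := div_lt_div_of_pos_right (rep_lt_one x) (by positivity : (0 : ℝ) < 2 ^ n)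
  linarith

theorem rep_div_two_pow_nonneg (n : ℕ) (x : Torus) : 0 ≤ rep x / 2 ^ n :=
  div_nonneg (rep_nonneg x) (by positivity)

theorem rep_branch (n : ℕ) (w : Fin n → Bool) (x : Torus) :
    rep (branch n w x) = wordVal n w + rep x / 2 ^ n :=
  rep_coe (add_nonneg (wordVal_nonneg n w) (rep_div_two_pow_nonneg n x))
    ((branch_arg_lt n w x).trans_le (wordVal_add_le_one n w))

theorem branch_zero (w : Fin 0 → Bool) (x : Torus) : branch 0 w x = x := by
  simp [branch, wordVal, coe_rep]

theorem branch_succ (n : ℕ) (w : Fin (n + 1) → Bool) (x : Torus) :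
    branch (n + 1) w x = preim (w 0) (branch n (Fin.tail w) x) := by
  rw [preim, rep_branch, branch, wordVal_succ, pow_succ, ← div_div]
  congr 1
  ring

theorem branch_append (n m : ℕ) (w : Fin n → Bool) (v : Fin m → Bool) (x : Torus) :
    branch (n + m) (Fin.append w v) x = branch n w (branch m v x) := by
  rw [branch, branch, rep_branch, wordVal_append, add_div, div_div, ← pow_add, add_comm m n,
    add_assoc]

theorem branch_injective (n : ℕ) (w : Fin n → Bool) : Function.Injective (branch n w) := by
  intro x y hxy
  have hr := congrArg rep hxy
  rw [rep_branch, rep_branch, add_right_inj, div_left_inj' (by positivity)] at hr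
  rw [← coe_rep x, hr, coe_rep]

theorem range_branch (n : ℕ) (w : Fin n → Bool) :
    range (branch n w) = rep ⁻¹' Ico (wordVal n w) (wordVal n w + 1 / 2 ^ n) := by
  have hp : (0 : ℝ) < 2 ^ n := by positivity
  ext y
  constructor
  · rintro ⟨x, rfl⟩
    rw [mem_preimage, rep_branch]
    exact ⟨le_add_of_nonneg_right (rep_div_two_pow_nonneg n x), branch_arg_lt n w x⟩
  · rintro ⟨h1, h2⟩
    have h3 : (rep y - wordVal n w) * 2 ^ n < 1 := by
      rw [← lt_div_iff₀ hp]
      linarith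
    refine ⟨(((rep y - wordVal n w) * 2 ^ n : ℝ) : Torus), ?_⟩
    rw [branch, rep_coe (mul_nonneg (by linarith) hp.le) h3, mul_div_cancel_right₀ _ hp.ne',
      add_sub_cancel, coe_rep]

theorem measurableSet_range_branch (n : ℕ) (w : Fin n → Bool) :
    MeasurableSet (range (branch n w)) := by
  rw [range_branch]
  exact measurable_rep measurableSet_Ico

theorem range_branch_subset_cyl (n : ℕ) (w : Fin n → Bool) : range (branch n w) ⊆ cyl n w := by
  rintro _ ⟨x, rfl⟩
  exact ⟨_, ⟨le_add_of_nonneg_right (rep_div_two_pow_nonneg n x), (branch_arg_lt n w x).le⟩, rfl⟩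

theorem cyl_subset_insert (n : ℕ) (w : Fin n → Bool) :
    cyl n w ⊆ insert ((wordVal n w + 1 / 2 ^ n : ℝ) : Torus) (range (branch n w)) := by
  rintro _ ⟨t, ⟨h1, h2⟩, rfl⟩
  rcases eq_or_lt_of_le h2 with h | h
  · exact Or.inl (congrArg _ h)
  · right
    rw [range_branch, mem_preimage]
    rw [rep_coe ((wordVal_nonneg n w).trans h1) (h.trans_le (wordVal_add_le_one n w))]
    exact ⟨h1, h⟩

section Invariance

/-! ### Invariance under the transfer operator, and its iterates -/

variable {c : Torus} {μ : Measure Torus}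

/-- The dual transfer operator applied to a measure. -/
def dualTransfer (c : Torus) (μ : Measure Torus) : Measure Torus :=
  (μ.withDensity fun x => ENNReal.ofReal (gfun c (preim false x))).map (preim false) +
    (μ.withDensity fun x => ENNReal.ofReal (gfun c (preim true x))).map (preim true)

theorem measurable_ofReal_gfun_preim (c : Torus) (a : Bool) :
    Measurable fun x => ENNReal.ofReal (gfun c (preim a x)) :=
  ((continuous_gfun c).measurable.comp (measurable_preim a)).ennreal_ofReal

theorem lintegral_dualTransfer {F : Torus → ℝ≥0∞} (hF : Measurable F) :
    ∫⁻ x, F x ∂(dualTransfer c μ) =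
      ∫⁻ x, (ENNReal.ofReal (gfun c (preim false x)) * F (preim false x) +
        ENNReal.ofReal (gfun c (preim true x)) * F (preim true x)) ∂μ := by
  have hm := measurable_ofReal_gfun_preim c
  have hFp : ∀ a, Measurable fun x => F (preim a x) := fun a => hF.comp (measurable_preim a)
  rw [dualTransfer, lintegral_add_measure, lintegral_map hF (measurable_preim _),
    lintegral_map hF (measurable_preim _), lintegral_withDensity_eq_lintegral_mul _ (hm _) (hFp _),
    lintegral_withDensity_eq_lintegral_mul _ (hm _) (hFp _),
    ← lintegral_add_left ((hm _).mul (hFp _))]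
  rfl

theorem IsGMeasure.eq_dualTransfer (hμ : IsGMeasure c μ) : μ = dualTransfer c μ := by
  have := hμ.1
  refine ext_of_forall_lintegral_eq_of_IsFiniteMeasure fun f => ?_
  have hfm : Measurable fun x => (f x : ℝ≥0∞) := f.continuous.measurable.coe_nnreal_ennreal
  let f' : C(Torus, ℝ) := ⟨fun x => (f x : ℝ), by fun_prop⟩
  have hint : Integrable f' μ := f'.continuous.integrable_of_hasCompactSupport
    (HasCompactSupport.of_compactSpace _)
  obtain ⟨C, hC⟩ := (isCompact_range f'.continuous).isBounded.exists_norm_le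
  have hC' : ∀ x, ‖f' x‖ ≤ C := fun x => hC _ ⟨x, rfl⟩
  have hg1 : ∀ x, gfun c x ≤ 1 := fun x => pow_le_one₀ (absCos_nonneg _) (absCos_le_one _)
  have hintp : ∀ a, Integrable (fun x => gfun c (preim a x) * f' (preim a x)) μ := by
    intro a
    refine Integrable.of_bound (C := C) ?_ (ae_of_all _ fun x => ?_)
    · exact ((((continuous_gfun c).mul f'.continuous).measurable).comp
        (measurable_preim a)).aestronglyMeasurable
    · rw [norm_mul, Real.norm_of_nonneg (gfun_nonneg _ _)]
      calc gfun c (preim a x) * ‖f' (preim a x)‖ ≤ 1 * ‖f' (preim a x)‖ :=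
            mul_le_mul_of_nonneg_right (hg1 _) (norm_nonneg _)
        _ ≤ C := by rw [one_mul]; exact hC' _
  have hf0 : ∀ x, 0 ≤ f' x := fun x => (f x).coe_nonneg
  have hof : ∀ x, (f x : ℝ≥0∞) = ENNReal.ofReal (f' x) := fun x => (ENNReal.ofReal_coe_nnreal).symm
  have hp0 : ∀ a x, 0 ≤ gfun c (preim a x) * f' (preim a x) :=
    fun a x => mul_nonneg (gfun_nonneg _ _) (hf0 _)
  have key := hμ.2 f'
  simp_rw [half_add_eq_preim, half_eq_preim] at key
  rw [lintegral_dualTransfer hfm]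
  simp_rw [hof]
  rw [← ofReal_integral_eq_lintegral_ofReal hint (ae_of_all _ hf0), key]
  refine (ofReal_integral_eq_lintegral_ofReal ((hintp false).add (hintp true))
    (ae_of_all _ fun x => add_nonneg (hp0 _ x) (hp0 _ x))).trans ?_
  refine lintegral_congr fun x => ?_
  rw [Pi.add_apply, ENNReal.ofReal_add (hp0 _ x) (hp0 _ x),
    ENNReal.ofReal_mul (gfun_nonneg _ _), ENNReal.ofReal_mul (gfun_nonneg _ _)]

theorem IsGMeasure.lintegral_eq (hμ : IsGMeasure c μ) {F : Torus → ℝ≥0∞} (hF : Measurable F) :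
    ∫⁻ x, F x ∂μ =
      ∫⁻ x, (EReal.exp (psi c (preim false x)) * F (preim false x) +
        EReal.exp (psi c (preim true x)) * F (preim true x)) ∂μ := by
  conv_lhs => rw [hμ.eq_dualTransfer]
  simp_rw [exp_psi]
  exact lintegral_dualTransfer hF

/-- Integrals of functions supported on a single inverse branch of the doubling map. -/
theorem IsGMeasure.lintegral_preim (hμ : IsGMeasure c μ) {F : Torus → ℝ≥0∞} (hF : Measurable F)
    (a : Bool) (hsupp : ∀ y ∉ range (preim a), F y = 0) :
    ∫⁻ x, F x ∂μ = ∫⁻ x, EReal.exp (psi c (preim a x)) * F (preim a x) ∂μ := by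
  rw [hμ.lintegral_eq hF]
  refine lintegral_congr fun x => ?_
  have h0 : F (preim (!a) x) = 0 := by
    apply hsupp
    rintro ⟨y, hy⟩
    exact preim_ne_preim (by simp) y x hy
  cases a
  · rw [Bool.not_false] at h0
    rw [h0, mul_zero, add_zero]
  · rw [Bool.not_true] at h0
    rw [h0, mul_zero, zero_add]

theorem IsGMeasure.lintegral_branch (hμ : IsGMeasure c μ) (n : ℕ) (w : Fin n → Bool)
    {F : Torus → ℝ≥0∞} (hF : Measurable F) (hsupp : ∀ y ∉ range (branch n w), F y = 0) :
    ∫⁻ x, F x ∂μ = ∫⁻ x, EReal.exp (psiSum c n (branch n w x)) * F (branch n w x) ∂μ := by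
  induction n generalizing F with
  | zero => simp [psiSum, branch_zero]
  | succ n ih =>
    have hrange : range (branch (n + 1) w) = preim (w 0) '' range (branch n (Fin.tail w)) := by
      rw [← range_comp]
      exact congrArg range (funext (branch_succ n w))
    rw [hμ.lintegral_preim hF (w 0), ih (Fin.tail w)]
    · refine lintegral_congr fun x => ?_
      rw [branch_succ, exp_psiSum_succ, dbl_preim, mul_assoc]
    · exact ((measurable_exp_psi c).comp (measurable_preim _)).mul (hF.comp (measurable_preim _))
    · intro y hy
      rw [hsupp, mul_zero]
      rwa [hrange, (preim_injective _).mem_set_image]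
    · refine fun y hy => hsupp y fun h => hy ?_
      rw [hrange] at h
      exact image_subset_range _ _ h

/-! ### Dyadic points are not charged -/

theorem IsGMeasure.measure_singleton (hμ : IsGMeasure c μ) (y : Torus) :
    μ {y} = EReal.exp (psi c y) * μ {dbl y} := by
  obtain ⟨a, ha⟩ : ∃ a, preim a (dbl y) = y := by
    have hy0 := rep_nonneg y
    have hy1 := rep_lt_one y
    rcases lt_or_ge (rep y) (1 / 2) with h | h
    · refine ⟨false, ?_⟩
      have hd : rep (dbl y) = 2 * rep y := by
        conv_lhs => rw [← coe_rep y, dbl_coe]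
        exact rep_coe (by linarith) (by linarith)
      rw [preim, hd]
      simp [digit, coe_rep]
    · refine ⟨true, ?_⟩
      have hd : rep (dbl y) = 2 * rep y - 1 := by
        have : dbl y = ((2 * rep y - 1 : ℝ) : Torus) := by
          conv_lhs => rw [← coe_rep y, dbl_coe]
          have h1 : ((1 : ℝ) : Torus) = 0 := by simp
          rw [AddCircle.coe_sub, h1, sub_zero]
        rw [this]
        exact rep_coe (by linarith) (by linarith)
      rw [preim, hd]
      simp [digit, coe_rep]
  have hF : Measurable (indicator {y} (1 : Torus → ℝ≥0∞)) :=
    measurable_one.indicator (measurableSet_singleton y)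
  have hsupp : ∀ z ∉ range (preim a), indicator {y} (1 : Torus → ℝ≥0∞) z = 0 := by
    intro z hz
    refine indicator_of_notMem (fun h => hz ?_) _
    rw [mem_singleton_iff.1 h]
    exact ⟨_, ha⟩
  rw [← lintegral_indicator_one (measurableSet_singleton y), hμ.lintegral_preim hF a hsupp,
    ← lintegral_indicator_const (measurableSet_singleton (dbl y))]
  refine lintegral_congr fun x => ?_
  by_cases hx : x = dbl y
  · simp [hx, ha]
  · have hne : preim a x ≠ y := fun h => hx (by rw [← h, dbl_preim])
    simp [hx, hne]

theorem IsGMeasure.measure_zero_singleton (hμ : IsGMeasure c μ) (hc : c ≠ 0) :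
    μ {(0 : Torus)} = 0 := by
  have := hμ.1
  have h := hμ.measure_singleton 0
  have hd : dbl 0 = 0 := add_zero 0
  rw [hd, exp_psi] at h
  by_contra hne
  have hlt : ENNReal.ofReal (gfun c 0) * μ {(0 : Torus)} < 1 * μ {(0 : Torus)} :=
    ENNReal.mul_lt_mul_left hne (measure_ne_top _ _)
      (ENNReal.ofReal_lt_one.2 (gfun_zero_lt_one hc))
  rw [one_mul, ← h] at hlt
  exact lt_irrefl _ hlt

theorem IsGMeasure.measure_singleton_of_iterate (hμ : IsGMeasure c μ) (hc : c ≠ 0) (n : ℕ)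
    {y : Torus} (hy : dbl^[n] y = 0) : μ {y} = 0 := by
  induction n generalizing y with
  | zero =>
    rw [Function.iterate_zero_apply] at hy
    rw [hy, hμ.measure_zero_singleton hc]
  | succ n ih => rw [hμ.measure_singleton, ih hy, mul_zero]

theorem IsGMeasure.measure_cyl (hμ : IsGMeasure c μ) (hc : c ≠ 0) (n : ℕ) (w : Fin n → Bool) :
    μ (cyl n w) = μ (range (branch n w)) := by
  refine le_antisymm ?_ (measure_mono (range_branch_subset_cyl n w))
  have hend : μ {((wordVal n w + 1 / 2 ^ n : ℝ) : Torus)} = 0 := by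
    refine hμ.measure_singleton_of_iterate hc n ?_
    obtain ⟨k, hk⟩ := exists_int_two_pow_mul_wordVal n w
    rw [dbl_iterate_coe, mul_add, hk, mul_one_div_cancel (by positivity)]
    exact_mod_cast coe_intCast_torus (k + 1)
  calc μ (cyl n w) ≤ μ (insert _ (range (branch n w))) := measure_mono (cyl_subset_insert n w)
    _ ≤ μ {((wordVal n w + 1 / 2 ^ n : ℝ) : Torus)} + μ (range (branch n w)) := by
        rw [insert_eq]
        exact measure_union_le _ _
    _ = μ (range (branch n w)) := by rw [hend, zero_add]

/-- The conformality relation for the measure of a concatenated cylinder. -/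
theorem IsGMeasure.measure_cyl_append (hμ : IsGMeasure c μ) (hc : c ≠ 0) (n m : ℕ)
    (w : Fin n → Bool) (v : Fin m → Bool) :
    μ (cyl (n + m) (Fin.append w v)) =
      ∫⁻ x in range (branch m v), EReal.exp (psiSum c n (branch n w x)) ∂μ := by
  have hrange : range (branch (n + m) (Fin.append w v)) = branch n w '' range (branch m v) := by
    rw [← range_comp]
    exact congrArg range (funext (branch_append n m w v))
  have hmeas := measurableSet_range_branch (n + m) (Fin.append w v)
  rw [hμ.measure_cyl hc, ← lintegral_indicator_one hmeas,
    hμ.lintegral_branch n w (measurable_one.indicator hmeas),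
    ← lintegral_indicator (measurableSet_range_branch m v)]
  · refine lintegral_congr fun x => ?_
    rw [hrange]
    by_cases hx : x ∈ range (branch m v)
    · rw [indicator_of_mem (mem_image_of_mem _ hx), indicator_of_mem hx, Pi.one_apply, mul_one]
    · rw [indicator_of_notMem (fun h => hx ((branch_injective n w).mem_set_image.1 h)),
        indicator_of_notMem hx, mul_zero]
  · intro y hy
    refine indicator_of_notMem (fun h => hy ?_) _
    rw [hrange] at h
    exact image_subset_range _ _ h

theorem IsGMeasure.gibbs_bounds (hμ : IsGMeasure c μ) (hc : c ≠ 0) (n m : ℕ)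
    (w : Fin n → Bool) (v : Fin m → Bool) :
    elog (μ (cyl m v)) + (⨅ x ∈ cyl (n + m) (Fin.append w v), psiSum c n x) ≤
        elog (μ (cyl (n + m) (Fin.append w v))) ∧
      elog (μ (cyl (n + m) (Fin.append w v))) ≤
        elog (μ (cyl m v)) + (⨆ x ∈ cyl (n + m) (Fin.append w v), psiSum c n x) := by
  have hlog : ∀ s : EReal, elog (μ (cyl m v)) + s =
      ENNReal.log (∫⁻ _ in range (branch m v), EReal.exp s ∂μ) := by
    intro s
    rw [setLIntegral_const, mul_comm, ENNReal.log_mul_add, EReal.log_exp, elog_eq_log,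
      hμ.measure_cyl hc]
  have hmem : ∀ x ∈ range (branch m v), branch n w x ∈ cyl (n + m) (Fin.append w v) := by
    rintro _ ⟨y, rfl⟩
    rw [← branch_append]
    exact range_branch_subset_cyl _ _ ⟨y, rfl⟩
  rw [hlog, hlog, elog_eq_log, hμ.measure_cyl_append hc]
  refine ⟨ENNReal.log_monotone ?_, ENNReal.log_monotone ?_⟩ <;>
    refine setLIntegral_mono' (measurableSet_range_branch m v) fun x hx =>
      EReal.exp_monotone ?_
  · exact iInf₂_le _ (hmem x hx)
  · exact le_iSup₂ (f := fun y _ => psiSum c n y) _ (hmem x hx)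

end Invariance

theorem cyl_zero (v : Fin 0 → Bool) : cyl 0 v = univ :=
  eq_univ_of_forall fun x =>
    range_branch_subset_cyl 0 v ⟨x, branch_zero v x⟩

/-- Gibbs-type bounds for a `g`-measure `μ` for `g^c` (`c ≠ 0`) on double
cylinders: `log μ⟨v⟩ + inf_{⟨wv⟩} ψ^c_n ≤ log μ⟨wv⟩ ≤ log μ⟨v⟩ + sup_{⟨wv⟩} ψ^c_n`;
in particular, for `v` the empty word, `inf_{⟨w⟩} ψ^c_n ≤ log μ⟨w⟩ ≤ sup_{⟨w⟩} ψ^c_n`. -/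
theorem stmt15 (c : Torus) (hc : c ≠ 0) (μ : Measure Torus) (hμ : IsGMeasure c μ)
    (n : ℕ) (hn : 1 ≤ n) (m : ℕ) (w : Fin n → Bool) (v : Fin m → Bool) :
    (elog (μ (cyl m v)) + (⨅ x ∈ cyl (n + m) (Fin.append w v), psiSum c n x) ≤
        elog (μ (cyl (n + m) (Fin.append w v))) ∧
      elog (μ (cyl (n + m) (Fin.append w v))) ≤
        elog (μ (cyl m v)) + (⨆ x ∈ cyl (n + m) (Fin.append w v), psiSum c n x)) ∧
    ((⨅ x ∈ cyl n w, psiSum c n x) ≤ elog (μ (cyl n w)) ∧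
      elog (μ (cyl n w)) ≤ ⨆ x ∈ cyl n w, psiSum c n x) := by
  refine ⟨hμ.gibbs_bounds hc n m w v, ?_⟩
  have := hμ.1
  have h := hμ.gibbs_bounds hc n 0 w Fin.elim0
  rw [Fin.append_elim0] at h
  simpa [cyl_zero, elog_eq_log] using h

end GTM
end
end

section
/- Let b = (b_i)_{i≥1} ∈ {0,1}^ℕ be a sequence that is not constant from index 2 onwards, i.e. there exists i ≥ 2 with b_i ≠ b_2 (this encodes that b is a binary expansion of c̆ = c + 1/2 with c ∉ {0, 1/2}). Then for every n ∈ ℕ there exists ℓ_n ∈ ℕ with the following property: for every word v ∈ {0,1}^n there exists a word u ∈ {0,1}^{ℓ_n} such that w = vu ∈ {0,1}^{n+ℓ_n} satisfies that for every 1 ≤ k ≤ n + ℓ_n, the suffix w_k w_{k+1} ⋯ w_{n+ℓ_n} is not a prefix of b. Moreover, there exists N ∈ ℕ such that for all n ≥ N one can choose ℓ_n ≤ 5·log₂(log_{3/2} n). -/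
namespace GTM

/-- Three prefixes of `b` occurring as suffixes of a common word: if the lengths satisfy
`m'' ≤ m + m'`, the continuations of the two shorter ones inside the longest one agree. -/
lemma continuation_eq {b w : ℕ → Bool} {n m m' m'' x : ℕ}
    (hm : ∀ j < m, w (n - m + j) = b j) (hm' : ∀ j < m', w (n - m' + j) = b j)
    (hm'' : ∀ j < m'', w (n - m'' + j) = b j) (h₁ : m < m') (h₂ : m' < m'') (hn : m'' ≤ n)
    (hx : m' + x < m'') (h : m'' ≤ m + m') : b (m + x) = b (m' + x) := by
  have e₁ : b (m' + x) = b (m + x + m' - m'') := by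
    rw [← hm'' _ hx, ← hm (m + x + m' - m'') (by omega)]
    congr 1; omega
  have e₂ : b (m + x) = b (m + x + m' - m'') := by
    rw [← hm'' (m + x) (by omega), ← hm' (m + x + m' - m'') (by omega)]
    congr 1; omega
  rw [e₁, e₂]

lemma card_le_of_doubling (T : Finset ℕ) (n l : ℕ) (hn : ∀ t ∈ T, t ≤ n)
    (hpos : ∀ t ∈ T, 1 ≤ t)
    (h : ∀ m ∈ T, ∀ m' ∈ T, ∀ m'' ∈ T, m < m' → m' + l ≤ m'' → 2 * m < m'') :
    T.card ≤ (l + 1) * (Nat.log 2 n + 1) := by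
  have himg : (T.image (Nat.log 2)).card ≤ Nat.log 2 n + 1 := by
    rw [← Finset.card_range (Nat.log 2 n + 1)]
    refine Finset.card_le_card fun e he => ?_
    obtain ⟨t, ht, rfl⟩ := Finset.mem_image.1 he
    exact Finset.mem_range.2 (Nat.lt_succ_of_le (Nat.log_mono_right (hn t ht)))
  refine (Finset.card_le_mul_card_image (f := Nat.log 2) T (l + 1) fun e _ => ?_).trans
    (Nat.mul_le_mul_left _ himg)
  set A := T.filter fun t => Nat.log 2 t = e with hA
  have bounds : ∀ t ∈ A, t ∈ T ∧ 2 ^ e ≤ t ∧ t < 2 ^ (e + 1) := by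
    intro t ht
    obtain ⟨htT, rfl⟩ := Finset.mem_filter.1 ht
    exact ⟨htT, Nat.pow_log_le_self 2 (by have := hpos t htT; omega),
      Nat.lt_pow_succ_log_self (by norm_num) t⟩
  rcases A.eq_empty_or_nonempty with h0 | hne
  · simp [h0]
  have hmA := A.min'_mem hne
  rw [← Finset.card_erase_add_one hmA]
  rcases (A.erase (A.min' hne)).eq_empty_or_nonempty with h1 | hne'
  · simp [h1]
  refine Nat.succ_le_succ ?_
  set m := A.min' hne
  set m' := (A.erase m).min' hne'
  have hm' : m' ∈ A.erase m := Finset.min'_mem _ _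
  have hm'A := Finset.mem_of_mem_erase hm'
  have hlt : m < m' := lt_of_le_of_ne (A.min'_le _ hm'A) (Finset.ne_of_mem_erase hm').symm
  have hsub : A.erase m ⊆ Finset.Ico m' (m' + l) := by
    intro t ht
    refine Finset.mem_Ico.2 ⟨Finset.min'_le _ _ ht, ?_⟩
    by_contra! hc
    obtain ⟨b1, b2, b3⟩ := bounds t (Finset.mem_of_mem_erase ht)
    obtain ⟨c1, c2, c3⟩ := bounds m hmA
    have := h m c1 m' (bounds m' hm'A).1 t b1 hlt hc
    rw [pow_succ] at b3
    omega
  simpa using Finset.card_le_card hsub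

/-- The lengths `m` such that the prefix of `b` of length `m` is a suffix of the word of length
`n` given by `w`. -/
def matchLengths (b w : ℕ → Bool) (n : ℕ) : Finset ℕ :=
  (Finset.Icc 1 n).filter fun m => ∀ j < m, w (n - m + j) = b j

lemma card_continuations_le (b w : ℕ → Bool) (n l : ℕ) :
    ((matchLengths b w n).image fun m (x : Fin l) => b (m + x)).card
      ≤ (l + 1) * (Nat.log 2 n + 1) := by
  obtain ⟨T, hTS, hinj, himg⟩ := Finset.exists_subset_injOn_image_eq_of_surjOn
    (f := fun m (x : Fin l) => b (m + x)) (matchLengths b w n)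
    ((matchLengths b w n).image fun m (x : Fin l) => b (m + x))
    (by rw [Finset.coe_image]; exact Set.surjOn_image _ _)
  rw [← himg]
  refine Finset.card_image_le.trans (card_le_of_doubling T n l ?_ ?_ ?_)
  · exact fun t ht => (Finset.mem_Icc.1 (Finset.mem_filter.1 (hTS ht)).1).2
  · exact fun t ht => (Finset.mem_Icc.1 (Finset.mem_filter.1 (hTS ht)).1).1
  · intro m hm m' hm' m'' hm'' hlt hle
    by_contra! hc
    refine hlt.ne (hinj hm hm' (funext fun x => ?_))
    have a := (Finset.mem_filter.1 (hTS hm)).2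
    have a' := (Finset.mem_filter.1 (hTS hm')).2
    have a'' := Finset.mem_filter.1 (hTS hm'')
    have hx := x.2
    exact continuation_eq a a' a''.2 hlt (by omega) (Finset.mem_Icc.1 a''.1).2 (by omega)
      (by omega)

/-- The words of length `l` whose last `j` letters form a prefix of `b`. -/
def wordsEndingIn (b : ℕ → Bool) (l j : ℕ) : Finset (Fin l → Bool) :=
  Finset.univ.filter fun u => ∀ y : Fin l, l ≤ y + j → u y = b (y + j - l)

lemma card_wordsEndingIn_le (b : ℕ → Bool) (l j : ℕ) :
    (wordsEndingIn b l j).card ≤ 2 ^ (l - j) := by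
  have : (Finset.univ : Finset (Fin (l - j) → Bool)).card = 2 ^ (l - j) := by simp
  rw [← this]
  refine Finset.card_le_card_of_injOn (fun u y => u ⟨y, by omega⟩) (fun _ _ => by simp) ?_
  intro u hu u' hu' h
  funext y
  by_cases hy : l ≤ y + j
  · rw [(Finset.mem_filter.1 hu).2 y hy, (Finset.mem_filter.1 hu').2 y hy]
  · exact congrFun h ⟨y, by omega⟩

lemma sum_two_pow_sub (l : ℕ) : ∑ j ∈ Finset.Icc 1 l, 2 ^ (l - j) + 1 = 2 ^ l := by
  induction l with
  | zero => simp
  | succ l ih =>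
    rw [Finset.sum_Icc_succ_top (by omega), pow_succ, ← ih, add_mul, Finset.sum_mul]
    have : ∀ j ∈ Finset.Icc 1 l, 2 ^ (l + 1 - j) = 2 ^ (l - j) * 2 := by
      intro j hj
      rw [← pow_succ]
      congr 1
      have := Finset.mem_Icc.1 hj
      omega
    rw [Finset.sum_congr rfl this]
    simp

/-- If the first letter of `b` reappears at position `i`, any sufficiently small family of words
can be avoided by a word without suffixes that are prefixes of `b`. -/
lemma exists_word_avoiding {b : ℕ → Bool} {i l : ℕ} (hi : 1 ≤ i) (hbi : b i = b 0)
    (hil : i + 1 ≤ l) (F : Finset (Fin l → Bool)) (hF : F.card ≤ 2 ^ (l - (i + 1))) :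
    ∃ u : Fin l → Bool, u ∉ F ∧ ∀ j, 1 ≤ j → j ≤ l → u ∉ wordsEndingIn b l j := by
  set J := (Finset.Icc 1 l).erase (i + 1)
  have hcard : (F ∪ J.biUnion (wordsEndingIn b l)).card < 2 ^ l := by
    have h₁ : (J.biUnion (wordsEndingIn b l)).card ≤ ∑ j ∈ J, 2 ^ (l - j) :=
      Finset.card_biUnion_le.trans (Finset.sum_le_sum fun j _ => card_wordsEndingIn_le b l j)
    have h₂ : ∑ j ∈ J, 2 ^ (l - j) + 2 ^ (l - (i + 1)) = ∑ j ∈ Finset.Icc 1 l, 2 ^ (l - j) :=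
      Finset.sum_erase_add _ _ (Finset.mem_Icc.2 ⟨by omega, hil⟩)
    have h₃ := sum_two_pow_sub l
    have h₄ := Finset.card_union_le F (J.biUnion (wordsEndingIn b l))
    omega
  obtain ⟨u, hu⟩ : ∃ u, u ∉ F ∪ J.biUnion (wordsEndingIn b l) := by
    by_contra! hc
    rw [Finset.eq_univ_of_forall hc] at hcard
    simp at hcard
  simp only [Finset.mem_union, Finset.mem_biUnion, not_or, not_exists, not_and] at hu
  refine ⟨u, hu.1, fun j hj hjl hmem => ?_⟩
  by_cases hji : j = i + 1
  · subst hji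
    refine hu.2 1 (Finset.mem_erase.2 ⟨by omega, Finset.mem_Icc.2 ⟨le_rfl, by omega⟩⟩) ?_
    refine Finset.mem_filter.2 ⟨Finset.mem_univ _, fun y hy => ?_⟩
    have hy' := y.2
    rw [(Finset.mem_filter.1 hmem).2 y (by omega), show (y : ℕ) + (i + 1) - l = i by omega,
      show (y : ℕ) + 1 - l = 0 by omega, hbi]
  · exact hu.2 j (Finset.mem_erase.2 ⟨hji, Finset.mem_Icc.2 ⟨hj, hjl⟩⟩) hmem

lemma exists_extension {b : ℕ → Bool} {i l n : ℕ} (hi : 1 ≤ i) (hbi : b i = b 0)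
    (hil : i + 1 ≤ l) (hl : (l + 1) * (Nat.log 2 n + 1) ≤ 2 ^ (l - (i + 1)))
    (v : Fin n → Bool) :
    ∃ u : Fin l → Bool, ∀ k : ℕ, k < n + l →
      ∃ j : ℕ, ∃ hj : k + j < n + l, Fin.append v u ⟨k + j, hj⟩ ≠ b j := by
  set w : ℕ → Bool := fun y => if h : y < n then v ⟨y, h⟩ else false with hw
  obtain ⟨u, huF, hu⟩ := exists_word_avoiding hi hbi hil _
    ((card_continuations_le b w n l).trans hl)
  have append_right : ∀ y (hy : y < l) (h : n + y < n + l),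
      Fin.append v u ⟨n + y, h⟩ = u ⟨y, hy⟩ := fun y hy _ => Fin.append_right v u ⟨y, hy⟩
  refine ⟨u, fun k hk => ?_⟩
  by_contra! hc
  rcases lt_or_ge k n with hkn | hkn
  · refine huF (Finset.mem_image.2 ⟨n - k, Finset.mem_filter.2
      ⟨Finset.mem_Icc.2 ⟨by omega, by omega⟩, fun j hj => ?_⟩, funext fun x => ?_⟩)
    · rw [← hc j (by omega), show n - (n - k) + j = k + j by omega]
      have hlt : k + j < n := by omega
      simp only [hw, hlt, dif_pos]
      exact (Fin.append_left v u ⟨k + j, hlt⟩).symm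
    · rw [← hc (n - k + x) (by omega), ← append_right x x.2 (by omega)]
      congr 2; omega
  · refine hu (n + l - k) (by omega) (by omega)
      (Finset.mem_filter.2 ⟨Finset.mem_univ _, fun y hy => ?_⟩)
    rw [← hc (y + (n + l - k) - l) (by omega), ← append_right y y.2 (by omega)]
    congr 2; omega

lemma length_bound {i n Q : ℕ} (hQ : Nat.log 2 (Nat.log 2 n) ≤ Q) (hiQ : i + 4 ≤ Q) :
    (4 * Q + 1) * (Nat.log 2 n + 1) ≤ 2 ^ (4 * Q - (i + 1)) := by
  have h₁ : Nat.log 2 n + 1 ≤ 2 ^ (Q + 1) :=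
    (Nat.lt_pow_succ_log_self (by norm_num) _).trans_le
      (Nat.pow_le_pow_right (by norm_num) (by omega))
  have h₂ : 4 * Q + 1 ≤ 2 ^ (Q + 2) := by
    have := Q.lt_two_pow_self
    rw [pow_add]
    omega
  refine (Nat.mul_le_mul h₂ h₁).trans ?_
  rw [← pow_add]
  exact Nat.pow_le_pow_right (by norm_num) (by omega)

lemma natLog_natLog_le {n : ℕ} (hn : 2 ≤ n) :
    (Nat.log 2 (Nat.log 2 n) : ℝ) ≤ Real.logb 2 (Real.logb (3 / 2) n) := by
  have hK : 0 < Nat.log 2 n := Nat.log_pos (by norm_num) hn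
  have hn' : (1 : ℝ) ≤ n := by exact_mod_cast (by omega : 1 ≤ n)
  have h₁ : (Nat.log 2 n : ℝ) ≤ Real.logb (3 / 2) n := by
    refine (Real.natLog_le_logb n 2).trans ?_
    rw [Real.logb, Real.logb]
    exact div_le_div_of_nonneg_left (Real.log_nonneg hn') (Real.log_pos (by norm_num))
      (Real.log_le_log (by norm_num) (by norm_num))
  exact (Real.natLog_le_logb _ 2).trans
    (Real.logb_le_logb_of_le (by norm_num) (by exact_mod_cast hK) h₁)

/-- Let `b = (b_i)_{i ≥ 1}` be a binary sequence (0-indexed here: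
`b 0 = b₁`) which is not constant from its second entry onwards. Then for every `n` there
is a length `ℓ_n` such that every word `v` of length `n` can be extended to `w = v u`
with `|u| = ℓ_n` so that no suffix of `w` is a prefix of `b`; moreover, eventually one can
choose `ℓ_n ≤ 5 log₂ log_{3/2} n`. -/
theorem stmt19 (b : ℕ → Bool) (hb : ∃ i : ℕ, 1 ≤ i ∧ b i ≠ b 1) :
    ∃ L : ℕ → ℕ,
      (∀ n : ℕ, ∀ v : Fin n → Bool, ∃ u : Fin (L n) → Bool,
        ∀ k : ℕ, k < n + L n →
          ∃ j : ℕ, ∃ hj : k + j < n + L n, Fin.append v u ⟨k + j, hj⟩ ≠ b j) ∧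
      ∃ N : ℕ, ∀ n : ℕ, N ≤ n →
        (L n : ℝ) ≤ 5 * Real.logb 2 (Real.logb (3 / 2) n) := by
  obtain ⟨i, hi, hbi⟩ : ∃ i, 1 ≤ i ∧ b i = b 0 := by
    obtain ⟨i, hi, hne⟩ := hb
    by_cases h : b 1 = b 0
    · exact ⟨1, le_rfl, h⟩
    · refine ⟨i, hi, ?_⟩
      revert hne h
      cases b i <;> cases b 1 <;> cases b 0 <;> simp
  refine ⟨fun n => 4 * max (Nat.log 2 (Nat.log 2 n)) (i + 4), fun n v => ?_,
    2 ^ 2 ^ (i + 4), fun n hn => ?_⟩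
  · exact exists_extension hi hbi (by omega)
      (length_bound (le_max_left _ _) (le_max_right _ _)) v
  · have h : i + 4 ≤ Nat.log 2 (Nat.log 2 n) :=
      Nat.le_log_of_pow_le (by norm_num) (Nat.le_log_of_pow_le (by norm_num) hn)
    have h₂ : 2 ≤ n := (Nat.le_self_pow (by positivity) 2).trans hn
    have h₃ := natLog_natLog_le h₂
    have h₄ : (0 : ℝ) ≤ Nat.log 2 (Nat.log 2 n) := Nat.cast_nonneg _
    simp only [max_eq_left h]
    push_cast
    linarith

end GTM
end
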